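/- arXiv:1504.01020 — 8 statements merged into one kernel-verified Lean document; each statement's English description precedes it below -/
import Mathlib

section
/- Let n ≥ 2, let r > 0, and let v : Fin n → ℝ be nondecreasing (v k is the (k+1)-st lowest bid). With the linear revenue curve R k = r·k, the expected profit of PEPA is at least one quarter of the constrained single-price benchmark: 2^{-n} · ∑_{S ⊆ Fin n} min(F(S), F(Sᶜ)) ≥ (1/4) · max_{2 ≤ k ≤ n} (r·k − k·v_k), where v_k denotes the k-th lowest bid. -/
/-- The optimal single-price profit that an omniscient auctioneer with revenue curve `R`
can extract from the set `S` of bidders (bids given by `v`): the maximum over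
`0 ≤ j ≤ |S|` of `R j − j · w_j`, where `w_1 ≤ … ≤ w_{|S|}` are the bids of `S`
sorted in nondecreasing order (the `j = 0` term being `R 0 = 0`). -/
noncomputable def singlePriceProfit {n : ℕ} (R : ℕ → ℝ) (v : Fin n → ℝ)
    (S : Finset (Fin n)) : ℝ :=
  (Finset.range (S.card + 1)).sup' (by simp)
    fun j => R j - (j : ℝ) * ((S.val.map v).sort (· ≤ ·)).getD (j - 1) 0

lemma sorted_getD_le (L : List ℝ) (hL : L.Pairwise (· ≤ ·)) (c : ℝ) (a : ℕ) (ha : 1 ≤ a)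
    (hc : a ≤ L.countP (fun x => decide (x ≤ c))) : L.getD (a - 1) 0 ≤ c := by
  by_contra hcon
  push Not at hcon
  have hlen : a ≤ L.length := hc.trans List.countP_le_length
  have hlt : a - 1 < L.length := by omega
  rw [List.getD_eq_getElem _ _ hlt] at hcon
  have h2 : (L.drop (a - 1)).countP (fun x => decide (x ≤ c)) = 0 := by
    rw [List.countP_eq_zero]
    intro x hx
    obtain ⟨i, hi, rfl⟩ := List.mem_iff_getElem.mp hx
    simp only [List.getElem_drop, decide_eq_true_eq, not_le]
    refine hcon.trans_le ?_
    rcases Nat.eq_zero_or_pos i with h | h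
    · subst h; simp
    · exact List.pairwise_iff_getElem.mp hL _ _ _ _ (by omega)
  have h1 : (L.take (a - 1)).countP (fun x => decide (x ≤ c)) ≤ a - 1 :=
    List.countP_le_length.trans (by simp)
  rw [← List.take_append_drop (a - 1) L, List.countP_append, h2] at hc
  omega

lemma profit_ge {n : ℕ} (r c : ℝ) (v : Fin n → ℝ) (S A : Finset (Fin n))
    (hA : ∀ i ∈ A, v i ≤ c) (hrc : 0 ≤ r - c) :
    ((A ∩ S).card : ℝ) * (r - c) ≤ singlePriceProfit (fun k => r * k) v S := by
  unfold singlePriceProfit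
  have hle : (A ∩ S).card ≤ S.card := Finset.card_le_card Finset.inter_subset_right
  refine le_trans ?_ (Finset.le_sup' _ (Finset.mem_range.mpr (Nat.lt_succ_of_le hle)))
  rcases Nat.eq_zero_or_pos (A ∩ S).card with h | h
  · simp [h]
  · have key := sorted_getD_le ((S.val.map v).sort (· ≤ ·)) (Multiset.pairwise_sort _ _) c
      (A ∩ S).card h (by
        rw [← Multiset.coe_countP, Multiset.sort_eq, Multiset.countP_map]
        have : Multiset.card (Multiset.filter (fun i => v i ≤ c) S.val)
          = (S.filter (fun i => v i ≤ c)).card := rfl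
        rw [this]
        apply Finset.card_le_card
        intro i hi
        rw [Finset.mem_inter] at hi
        exact Finset.mem_filter.mpr ⟨hi.2, hA i hi.1⟩)
    have : (0 : ℝ) ≤ (A ∩ S).card := Nat.cast_nonneg _
    nlinarith

lemma profit_nonneg {n : ℕ} (r : ℝ) (v : Fin n → ℝ) (S : Finset (Fin n)) :
    0 ≤ singlePriceProfit (fun k => r * k) v S := by
  unfold singlePriceProfit
  refine le_trans ?_ (Finset.le_sup' _ (Finset.mem_range.mpr (Nat.succ_pos S.card)))
  simp

lemma count_sep {n : ℕ} (x y : Fin n) (h : x ≠ y) :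
    4 * (∑ S : Finset (Fin n), if x ∈ S ∧ y ∉ S then 1 else 0) = 2 ^ n := by
  rw [← Finset.card_filter]
  have : (Finset.univ.filter (fun S : Finset (Fin n) => x ∈ S ∧ y ∉ S))
      = Finset.Icc {x} ({y}ᶜ) := by
    ext S
    simp [Finset.subset_compl_singleton]
  have hn : 2 ≤ n := by have := x.2; have := y.2; have := Fin.val_ne_of_ne h; omega
  rw [this, Finset.card_Icc_finset (by simpa using h.symm), Finset.card_compl]
  simp only [Fintype.card_fin, Finset.card_singleton]
  obtain ⟨m, rfl⟩ := Nat.exists_eq_add_of_le hn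
  rw [show 2 + m - 1 - 1 = m by omega, pow_add]; norm_num

lemma sum_prod {n : ℕ} (A : Finset (Fin n)) :
    4 * (∑ S : Finset (Fin n), (A ∩ S).card * (A ∩ Sᶜ).card)
      = A.card * (A.card - 1) * 2 ^ n := by
  have h1 : ∀ S : Finset (Fin n), (A ∩ S).card * (A ∩ Sᶜ).card
      = ∑ p ∈ A.offDiag, if p.1 ∈ S ∧ p.2 ∉ S then 1 else 0 := by
    intro S
    rw [← Finset.card_filter, ← Finset.card_product]
    congr 1
    ext ⟨x, y⟩
    simp only [Finset.mem_product, Finset.mem_inter, Finset.mem_compl, Finset.mem_filter,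
      Finset.mem_offDiag]
    constructor
    · rintro ⟨⟨a, b⟩, c, d⟩
      exact ⟨⟨a, c, fun h => d (h ▸ b)⟩, b, d⟩
    · rintro ⟨⟨a, c, -⟩, b, d⟩
      exact ⟨⟨a, b⟩, c, d⟩
  simp_rw [h1]
  rw [Finset.sum_comm, Finset.mul_sum, Finset.sum_congr rfl
    (fun p hp => count_sep p.1 p.2 (Finset.mem_offDiag.mp hp).2.2)]
  rw [Finset.sum_const, Finset.offDiag_card, smul_eq_mul, Nat.mul_sub_one]

lemma sum_min {n : ℕ} (A : Finset (Fin n)) (hA : 2 ≤ A.card) :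
    A.card * 2 ^ n ≤ 4 * ∑ S : Finset (Fin n), min (A ∩ S).card (A ∩ Sᶜ).card := by
  have h : ∀ S : Finset (Fin n), (A ∩ S).card * (A ∩ Sᶜ).card
      ≤ (A.card - 1) * min (A ∩ S).card (A ∩ Sᶜ).card := by
    intro S
    have hs : (A ∩ S).card + (A ∩ Sᶜ).card = A.card := by
      rw [← Finset.sdiff_eq_inter_compl, Finset.card_inter_add_card_sdiff]
    generalize (A ∩ S).card = a at *
    generalize (A ∩ Sᶜ).card = b at *
    rcases Nat.eq_zero_or_pos a with ha | ha
    · simp [ha]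
    rcases Nat.eq_zero_or_pos b with hb | hb
    · simp [hb]
    rcases le_total a b with hab | hab
    · rw [min_eq_left hab, mul_comm]
      exact Nat.mul_le_mul_right _ (by omega)
    · rw [min_eq_right hab]
      exact Nat.mul_le_mul_right _ (by omega)
  have h2 := Finset.sum_le_sum (fun S (_ : S ∈ Finset.univ) => h S)
  rw [← Finset.mul_sum] at h2
  have h3 := sum_prod A
  refine le_of_mul_le_mul_left (a := A.card - 1) ?_ (Nat.sub_pos_of_lt hA)
  calc (A.card - 1) * (A.card * 2 ^ n) = A.card * (A.card - 1) * 2 ^ n := by ring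
    _ ≤ _ := by rw [← h3]; nlinarith

/-- **Theorem 2 of the paper.** PEPA is 4-competitive against the optimal single-price
auction constrained to buy at least two units, for the linear revenue curve `R k = r·k`:
the expected profit `2^{-n} ∑_{S ⊆ Fin n} min(F(S), F(Sᶜ))` of PEPA is at least
`(1/4) · max_{2 ≤ k ≤ n} (r·k − k·v_k)`, where `v_k` is the `k`-th lowest bid. -/
theorem pepa_four_competitive_linear (n : ℕ) (hn : 2 ≤ n) (r : ℝ) (hr : 0 < r)
    (v : Fin n → ℝ) (hv : Monotone v) :
    ((2 : ℝ) ^ n)⁻¹ *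
        ∑ S : Finset (Fin n),
          min (singlePriceProfit (fun k => r * k) v S)
            (singlePriceProfit (fun k => r * k) v Sᶜ) ≥
      (1 / 4) *
        (Finset.Icc 2 n).sup' ⟨2, Finset.mem_Icc.mpr ⟨le_rfl, hn⟩⟩
          (fun k => r * k - (k : ℝ) * (List.ofFn v).getD (k - 1) 0) := by
  have h2n : (0 : ℝ) < 2 ^ n := by positivity
  rw [ge_iff_le, inv_mul_eq_div, le_div_iff₀ h2n]
  suffices hk : ∀ k ∈ Finset.Icc 2 n,
      r * k - (k : ℝ) * (List.ofFn v).getD (k - 1) 0 ≤ 4 * (∑ S : Finset (Fin n),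
          min (singlePriceProfit (fun k => r * k) v S)
            (singlePriceProfit (fun k => r * k) v Sᶜ)) / 2 ^ n by
    have := Finset.sup'_le ⟨2, Finset.mem_Icc.mpr ⟨le_rfl, hn⟩⟩ _ hk
    rw [le_div_iff₀ h2n] at this
    linarith
  intro k hk
  rw [Finset.mem_Icc] at hk
  rw [le_div_iff₀ h2n, List.getD_eq_getElem _ _ (by simp; omega), List.getElem_ofFn]
  generalize hc : v ⟨k - 1, _⟩ = c
  rcases le_or_gt c r with hcr | hcr
  · have hA : ∀ i ∈ Finset.univ.filter (fun i : Fin n => i.val < k), v i ≤ c := by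
      intro i hi
      rw [Finset.mem_filter] at hi
      rw [← hc]
      apply hv
      rw [Fin.le_def]
      have := hi.2
      simp only
      omega
    have hcard : (Finset.univ.filter (fun i : Fin n => i.val < k)).card = k := by
      rw [Fin.card_filter_val_lt]
      omega
    generalize Finset.univ.filter (fun i : Fin n => i.val < k) = A at hA hcard
    have hm := sum_min A (by omega)
    have hm' : (k : ℝ) * 2 ^ n
        ≤ 4 * ∑ S : Finset (Fin n), min ((A ∩ S).card : ℝ) ((A ∩ Sᶜ).card : ℝ) := by
      rw [hcard] at hm
      exact_mod_cast hm
    have hrc : 0 ≤ r - c := by linarith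
    have hs : (∑ S : Finset (Fin n), min ((A ∩ S).card : ℝ) ((A ∩ Sᶜ).card : ℝ)) * (r - c)
        ≤ ∑ S : Finset (Fin n), min (singlePriceProfit (fun k => r * k) v S)
            (singlePriceProfit (fun k => r * k) v Sᶜ) := by
      rw [Finset.sum_mul]
      apply Finset.sum_le_sum
      intro S _
      rw [min_mul_of_nonneg _ _ hrc]
      exact min_le_min (profit_ge r c v S A hA hrc) (profit_ge r c v Sᶜ A hA hrc)
    have := mul_le_mul_of_nonneg_right hm' hrc
    nlinarith
  · have h0 : 0 ≤ ∑ S : Finset (Fin n), min (singlePriceProfit (fun k => r * k) v S)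
            (singlePriceProfit (fun k => r * k) v Sᶜ) :=
      Finset.sum_nonneg fun S _ => le_min (profit_nonneg r v S) (profit_nonneg r v Sᶜ)
    have h1 : r * k - (k : ℝ) * c ≤ 0 := by
      have : (0 : ℝ) ≤ k := Nat.cast_nonneg _
      nlinarith
    have := mul_nonpos_of_nonpos_of_nonneg h1 h2n.le
    linarith
end

section
/- Let n ≥ 2 and let v : Fin n → ℝ be nondecreasing. Let R : ℕ → ℝ satisfy R 0 = 0 and j·R i ≥ i·R j whenever 1 ≤ i ≤ j. Then 2^{-n} · ∑_{S ⊆ Fin n} min(F(S), F(Sᶜ)) ≥ (1/4) · max_{2 ≤ k ≤ n} (R k − k·v_k), where v_k denotes the k-th lowest bid. -/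
theorem pepa_list_aux (c : ℝ) : ∀ (L : List ℝ), L.Pairwise (· ≤ ·) → ∀ j : ℕ,
    j < L.countP (fun x => decide (x ≤ c)) → L.getD j 0 ≤ c := by
  intro L
  induction L with
  | nil => intro _ j hj; simp at hj
  | cons x L ih =>
    intro hp j hj
    rw [List.pairwise_cons] at hp
    cases j with
    | zero =>
      obtain ⟨y, hy, hyc⟩ := List.countP_pos_iff.mp hj
      have hyc' : y ≤ c := by simpa using hyc
      rcases List.mem_cons.mp hy with h | h
      · simpa [← h] using hyc'
      · simpa using (hp.1 y h).trans hyc'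
    | succ j =>
      rw [List.countP_cons] at hj
      have : j < L.countP (fun x => decide (x ≤ c)) := by split_ifs at hj <;> omega
      simpa using ih hp.2 j this

theorem pepa_profit_nonneg {n : ℕ} (R : ℕ → ℝ) (hR0 : R 0 = 0) (v : Fin n → ℝ)
    (S : Finset (Fin n)) : 0 ≤ singlePriceProfit R v S := by
  unfold singlePriceProfit
  refine le_trans ?_ (Finset.le_sup' _ (b := 0) (by simp))
  simp [hR0]

theorem pepa_profit_ge {n : ℕ} (R : ℕ → ℝ) (v : Fin n → ℝ)
    (S K : Finset (Fin n)) (c : ℝ) (hK : ∀ i ∈ K, v i ≤ c) :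
    R (S ∩ K).card - ((S ∩ K).card : ℝ) * c ≤ singlePriceProfit R v S := by
  unfold singlePriceProfit
  have hle : (S ∩ K).card ≤ S.card := Finset.card_le_card Finset.inter_subset_left
  refine le_trans ?_ (Finset.le_sup' _ (b := (S ∩ K).card) (by simp; omega))
  rcases Nat.eq_zero_or_pos (S ∩ K).card with h | h
  · simp [h]
  have key : ((S.val.map v).sort (· ≤ ·)).getD ((S ∩ K).card - 1) 0 ≤ c := by
    apply pepa_list_aux c _ (Multiset.pairwise_sort _ _)
    rw [← Multiset.coe_countP (fun x => x ≤ c), Multiset.sort_eq, Multiset.countP_map]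
    have h2 : (S ∩ K).card ≤ (S.filter (fun i => v i ≤ c)).card := by
      apply Finset.card_le_card
      intro i hi
      rw [Finset.mem_inter] at hi
      exact Finset.mem_filter.mpr ⟨hi.1, hK i hi.2⟩
    have h3 : (S.filter (fun i => v i ≤ c)).card
      = (Multiset.filter (fun i => v i ≤ c) S.val).card := rfl
    omega
  have := mul_le_mul_of_nonneg_left key (Nat.cast_nonneg (α := ℝ) (S ∩ K).card)
  linarith

theorem pepa_pair {n : ℕ} (x y : Fin n) (hxy : x ≠ y) :
    ∑ S : Finset (Fin n), (if (x ∈ S ↔ y ∈ S) then (0 : ℝ) else 1) = 2 ^ n / 2 := by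
  have hinv : Function.Involutive (fun S : Finset (Fin n) => symmDiff S {x}) := by
    intro S; simp
  let e : Equiv.Perm (Finset (Fin n)) := hinv.toPerm
  have he : ∀ S, e S = symmDiff S {x} := fun _ => rfl
  have h1 := Equiv.sum_comp e
    (fun S : Finset (Fin n) => if (x ∈ S ↔ y ∈ S) then (0 : ℝ) else 1)
  have h2 : ∑ S : Finset (Fin n), ((if (x ∈ S ↔ y ∈ S) then (0 : ℝ) else 1) +
      (if (x ∈ e S ↔ y ∈ e S) then (0 : ℝ) else 1)) = 2 ^ n := by
    rw [Finset.sum_congr rfl (g := fun _ => (1 : ℝ))]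
    · simp
    · intro S _
      have hyx : y ≠ x := hxy.symm
      by_cases hx : x ∈ S <;> by_cases hy : y ∈ S <;>
        simp [he, Finset.mem_symmDiff, hx, hy, hyx]
  rw [Finset.sum_add_distrib, h1] at h2
  linarith

theorem pepa_count {n : ℕ} (S K : Finset (Fin n)) :
    ∑ x ∈ K, ∑ y ∈ K, (if (x ∈ S ↔ y ∈ S) then (0 : ℝ) else 1)
      = 2 * ((S ∩ K).card : ℝ) * ((Sᶜ ∩ K).card : ℝ) := by
  have e : ∀ x y : Fin n, (if (x ∈ S ↔ y ∈ S) then (0 : ℝ) else 1) =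
      (if x ∈ S then 1 else 0) * (if y ∈ Sᶜ then 1 else 0) +
      (if x ∈ Sᶜ then 1 else 0) * (if y ∈ S then 1 else 0) := by
    intro x y
    by_cases hx : x ∈ S <;> by_cases hy : y ∈ S <;> simp [hx, hy]
  have c : ∀ T : Finset (Fin n), ∑ x ∈ K, (if x ∈ T then (1 : ℝ) else 0) = (T ∩ K).card := by
    intro T
    rw [Finset.sum_boole, Finset.filter_mem_eq_inter, Finset.inter_comm]
  simp_rw [e, Finset.sum_add_distrib, ← Finset.mul_sum, ← Finset.sum_mul, c]
  ring

theorem pepa_total {n : ℕ} (K : Finset (Fin n)) :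
    ∑ S : Finset (Fin n), ((S ∩ K).card : ℝ) * ((Sᶜ ∩ K).card : ℝ)
      = 2 ^ n * (K.card * (K.card - 1)) / 4 := by
  have h : ∑ S : Finset (Fin n), 2 * ((S ∩ K).card : ℝ) * ((Sᶜ ∩ K).card : ℝ)
      = K.card * (K.card - 1) * (2 ^ n / 2) := by
    simp_rw [← pepa_count]
    rw [Finset.sum_comm]
    have : ∀ x ∈ K, ∑ S : Finset (Fin n), ∑ y ∈ K, (if (x ∈ S ↔ y ∈ S) then (0 : ℝ) else 1)
        = (K.card - 1) * (2 ^ n / 2) := by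
      intro x hx
      rw [Finset.sum_comm, ← Finset.add_sum_erase _ _ hx,
        Finset.sum_congr rfl (fun y hy => pepa_pair x y (Finset.ne_of_mem_erase hy).symm)]
      rw [Finset.sum_const, Finset.card_erase_of_mem hx, nsmul_eq_mul,
        Nat.cast_sub (Finset.card_pos.mpr ⟨x, hx⟩)]
      simp
    rw [Finset.sum_congr rfl this, Finset.sum_const, nsmul_eq_mul]
    ring
  simp_rw [mul_assoc, ← Finset.mul_sum] at h
  linarith

theorem pepa_four_competitive_concave (n : ℕ) (hn : 2 ≤ n)
    (v : Fin n → ℝ) (hv : Monotone v)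
    (R : ℕ → ℝ) (hR0 : R 0 = 0)
    (hconc : ∀ i j : ℕ, 1 ≤ i → i ≤ j → (j : ℝ) * R i ≥ (i : ℝ) * R j) :
    ((2 : ℝ) ^ n)⁻¹ *
        ∑ S : Finset (Fin n),
          min (singlePriceProfit R v S) (singlePriceProfit R v Sᶜ) ≥
      (1 / 4) *
        (Finset.Icc 2 n).sup' ⟨2, Finset.mem_Icc.mpr ⟨le_rfl, hn⟩⟩
          (fun k => R k - (k : ℝ) * (List.ofFn v).getD (k - 1) 0) := by
  obtain ⟨k, hk, hkeq⟩ := Finset.exists_mem_eq_sup' (s := Finset.Icc 2 n)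
    ⟨2, Finset.mem_Icc.mpr ⟨le_rfl, hn⟩⟩
    (fun k => R k - (k : ℝ) * (List.ofFn v).getD (k - 1) 0)
  rw [hkeq]
  obtain ⟨hk2, hkn⟩ := Finset.mem_Icc.mp hk
  have hlt : k - 1 < n := by omega
  have hget : (List.ofFn v).getD (k - 1) 0 = v ⟨k - 1, hlt⟩ := by
    rw [List.getD_eq_getElem _ _ (by simpa using hlt)]
    simp
  simp only [hget]
  set c := v ⟨k - 1, hlt⟩ with hc
  set P := R k - (k : ℝ) * c with hP
  have hpow : (0 : ℝ) < 2 ^ n := by positivity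
  rcases le_or_gt P 0 with hP0 | hP0
  · have : 0 ≤ ∑ S : Finset (Fin n),
        min (singlePriceProfit R v S) (singlePriceProfit R v Sᶜ) :=
      Finset.sum_nonneg fun S _ =>
        le_min (pepa_profit_nonneg R hR0 v S) (pepa_profit_nonneg R hR0 v Sᶜ)
    have h2 : 0 ≤ ((2 : ℝ) ^ n)⁻¹ * ∑ S : Finset (Fin n),
        min (singlePriceProfit R v S) (singlePriceProfit R v Sᶜ) := by positivity
    linarith
  set K : Finset (Fin n) := Finset.Iic ⟨k - 1, hlt⟩ with hKdef
  have hKcard : K.card = k := by rw [hKdef, Fin.card_Iic]; simp; omega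
  have hKle : ∀ i ∈ K, v i ≤ c := fun i hi => hv (Finset.mem_Iic.mp hi)
  have hk2' : (2 : ℝ) ≤ k := by exact_mod_cast hk2
  have hkpos : (0 : ℝ) < k := by linarith
  have hF : ∀ S : Finset (Fin n),
      ((S ∩ K).card : ℝ) * P ≤ k * singlePriceProfit R v S := by
    intro S
    have h1 := pepa_profit_ge R v S K c hKle
    have hle : (S ∩ K).card ≤ k := hKcard ▸ Finset.card_le_card Finset.inter_subset_right
    have h2 : ((S ∩ K).card : ℝ) * R k ≤ k * R (S ∩ K).card := by
      rcases Nat.eq_zero_or_pos (S ∩ K).card with h | h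
      · simp [h, hR0]
      · exact hconc _ _ h hle
    have h3 := mul_le_mul_of_nonneg_left h1 hkpos.le
    rw [hP]
    nlinarith
  have hsum : ∀ S : Finset (Fin n), (S ∩ K).card + (Sᶜ ∩ K).card = k := by
    intro S
    rw [← hKcard, ← Finset.card_inter_add_card_sdiff K S, Finset.inter_comm K S]
    congr 2
    ext i; simp [and_comm]
  have hmin : ∀ S : Finset (Fin n),
      P / (k * (k - 1)) * (((S ∩ K).card : ℝ) * ((Sᶜ ∩ K).card : ℝ)) ≤
        min (singlePriceProfit R v S) (singlePriceProfit R v Sᶜ) := by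
    have gen : ∀ (a b : ℕ) (F : ℝ), a + b = k → 0 ≤ F → (a : ℝ) * P ≤ k * F →
        P / (k * (k - 1)) * ((a : ℝ) * b) ≤ F := by
      intro a b F hab hF0 haF
      rcases Nat.eq_zero_or_pos a with h | h
      · simpa [h] using hF0
      have hb : (b : ℝ) ≤ k - 1 := by
        have : b + 1 ≤ k := by omega
        have : (b : ℝ) + 1 ≤ k := by exact_mod_cast this
        linarith
      have hk1 : (0 : ℝ) < k - 1 := by linarith
      rw [div_mul_eq_mul_div, div_le_iff₀ (by positivity)]
      have h1 : (a : ℝ) * P * b ≤ a * P * (k - 1) :=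
        mul_le_mul_of_nonneg_left hb (by positivity)
      have h2 := mul_le_mul_of_nonneg_right haF hk1.le
      linarith
    intro S
    refine le_min (gen _ _ _ (hsum S) (pepa_profit_nonneg R hR0 v S) (hF S)) ?_
    rw [mul_comm ((S ∩ K).card : ℝ)]
    exact gen _ _ _ (by rw [add_comm]; exact hsum S) (pepa_profit_nonneg R hR0 v Sᶜ) (hF Sᶜ)
  have htot := Finset.sum_le_sum (s := Finset.univ) fun S _ => hmin S
  rw [← Finset.mul_sum, pepa_total, hKcard] at htot
  have hk1 : (k : ℝ) - 1 ≠ 0 := by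
    have : (0 : ℝ) < k - 1 := by linarith
    exact this.ne'
  have heq : P / (k * (k - 1)) * (2 ^ n * ((k : ℝ) * (k - 1)) / 4) = 2 ^ n * (1 / 4 * P) := by
    field_simp
  rw [heq] at htot
  rw [ge_iff_le, inv_mul_eq_div, le_div_iff₀ hpow]
  linarith
end

section
/- For every Borel probability measure μ on ℝ, every real r > 0, and every real β ≥ 1, there exists L with 0 < L < r such that ∫_{y ∈ [L, r]} (r − y) dμ(y) ≤ (r − L)/β. -/
open MeasureTheory

/-- **Analytic core of Theorem 1 of the paper.** For any Borel probability measure `μ`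
on `ℝ` (the distribution of the random offered price `f(r, R)` of a bid-independent
auction), any `r > 0` (the revenue `R(1)`), and any `β ≥ 1`, there is a low bid `L`
with `0 < L < r` such that the auction's expected profit `∫_{[L,r]} (r − y) dμ(y)`
is at most `(r − L)/β`, i.e. at most a `1/β` fraction of the optimal single-price
profit `F = r − L`.  Hence no truthful auction is constant-competitive against `F`. -/
theorem no_constant_competitive_auction (μ : Measure ℝ) [IsProbabilityMeasure μ]
    (r : ℝ) (hr : 0 < r) (β : ℝ) (hβ : 1 ≤ β) :
    ∃ L : ℝ, 0 < L ∧ L < r ∧ (∫ y in Set.Icc L r, (r - y) ∂μ) ≤ (r - L) / β := by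
  have hβ0 : 0 < β := by linarith
  let a : ℕ → ℝ := fun n => r - r / ((n : ℝ) + 2)
  have hanti : Antitone (fun n : ℕ => Set.Ico (a n) r) := by
    intro m n hmn
    apply Set.Ico_subset_Ico_left
    have : (m : ℝ) ≤ n := by exact_mod_cast hmn
    have h : r / ((n : ℝ) + 2) ≤ r / ((m : ℝ) + 2) := by gcongr
    simp only [a]
    linarith
  have hempty : (⋂ n : ℕ, Set.Ico (a n) r) = ∅ := by
    ext y
    simp only [Set.mem_iInter, Set.mem_Ico, Set.mem_empty_iff_false, iff_false]
    intro h
    have hy : 0 < r - y := by linarith [(h 0).2]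
    obtain ⟨n, hn⟩ := exists_nat_gt (r / (r - y))
    have h1 := (h n).1
    have h2 : r / ((n : ℝ) + 2) < r - y := by
      rw [div_lt_iff₀ hy] at hn
      rw [div_lt_iff₀ (by positivity)]
      nlinarith
    simp only [a] at h1
    linarith
  have ht : Filter.Tendsto (fun n : ℕ => μ (Set.Ico (a n) r)) Filter.atTop (nhds 0) := by
    have := tendsto_measure_iInter_atTop (μ := μ) (s := fun n : ℕ => Set.Ico (a n) r)
      (fun n => measurableSet_Ico.nullMeasurableSet) hanti ⟨0, measure_ne_top _ _⟩
    rw [hempty, measure_empty] at this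
    exact this
  have hε : (0 : ENNReal) < ENNReal.ofReal (1 / β) := by
    rw [ENNReal.ofReal_pos]; positivity
  obtain ⟨n, hn⟩ := (ht.eventually_lt_const hε).exists
  have hreal : μ.real (Set.Ico (a n) r) ≤ 1 / β :=
    ENNReal.toReal_le_of_le_ofReal (by positivity) hn.le
  have hpos : 0 < r / ((n : ℝ) + 2) := by positivity
  have hlt : r / ((n : ℝ) + 2) < r := div_lt_self hr (by have : (0 : ℝ) ≤ n := n.cast_nonneg
                                                         linarith)
  have har : a n < r := by simp only [a]; linarith
  refine ⟨a n, by simp only [a]; linarith, har, ?_⟩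
  have heq : (∫ y in Set.Icc (a n) r, (r - y) ∂μ) = ∫ y in Set.Ico (a n) r, (r - y) ∂μ := by
    apply setIntegral_eq_of_subset_of_forall_diff_eq_zero measurableSet_Icc
      Set.Ico_subset_Icc_self
    rintro y ⟨h1, h2⟩
    by_contra hne
    exact h2 ⟨h1.1, lt_of_le_of_ne h1.2 (fun h => hne (by rw [h, sub_self]))⟩
  rw [heq]
  have hb := norm_setIntegral_le_of_norm_le_const (μ := μ) (s := Set.Ico (a n) r)
    (f := fun y => r - y) (C := r - a n) (measure_lt_top _ _) (by
      intro y hy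
      rw [Real.norm_eq_abs, abs_le]
      constructor <;> linarith [hy.1, hy.2])
  calc _ ≤ _ := Real.le_norm_self _
    _ ≤ _ := hb
    _ ≤ (r - a n) * (1 / β) := by
      apply mul_le_mul_of_nonneg_left hreal; linarith
    _ = _ := by ring
end

section
/- Let n ≥ 2, let q ≥ 1 be a natural number (the common capacity), let v : Fin n → ℝ be nondecreasing, and let R : ℕ → ℝ satisfy R 0 = 0 and j·R i ≥ i·R j whenever 1 ≤ i ≤ j. For S ⊆ Fin n define F_q(S) := max_{0 ≤ x ≤ q·|S|} (R x − x·w_{⌈x/q⌉}(S)), where w_j(S) is the j-th lowest value of v on S and the x = 0 term is 0. Then 2^{-n} · ∑_{S ⊆ Fin n} min(F_q(S), F_q(Sᶜ)) ≥ (1/4) · max_{q < x ≤ q·n} (R x − x·v_{⌈x/q⌉}), where v_j denotes the j-th lowest bid. -/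
/-- The optimal single-price profit that an omniscient auctioneer with revenue curve `R`
can extract from a set `S` of sellers, each with per-unit valuation given by `v` and
common capacity `q`: the maximum over `0 ≤ x ≤ q·|S|` of `R x − x · w_{⌈x/q⌉}`, where
`w_1 ≤ … ≤ w_{|S|}` are the valuations of `S` sorted in nondecreasing order
(`⌈x/q⌉ = (x + q - 1)/q` is the index of the marginal seller; the `x = 0` term is
`R 0 = 0`). -/
noncomputable def capSinglePriceProfit {n : ℕ} (R : ℕ → ℝ) (v : Fin n → ℝ) (q : ℕ)
    (S : Finset (Fin n)) : ℝ :=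
  (Finset.range (q * S.card + 1)).sup' (by simp)
    fun x => R x - (x : ℝ) * ((S.val.map v).sort (· ≤ ·)).getD ((x + q - 1) / q - 1) 0

theorem aux_getD (p : ℝ) : ∀ (l : List ℝ) (m : ℕ), l.Pairwise (· ≤ ·) →
    m < l.countP (fun a => decide (a ≤ p)) → l.getD m 0 ≤ p := by
  intro l
  induction l with
  | nil => intro m _ h; simp at h
  | cons a l ih =>
    intro m hs h
    rw [List.pairwise_cons] at hs
    rw [List.countP_cons] at h
    cases m with
    | zero =>
      simp only [List.getD_cons_zero]
      by_contra hc
      simp only [hc, decide_false, Bool.false_eq_true, if_false, add_zero] at h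
      obtain ⟨b, hb, hbp⟩ := List.countP_pos_iff.mp h
      have h1 := hs.1 b hb
      have h2 : b ≤ p := by simpa using hbp
      exact hc (h1.trans h2)
    | succ m =>
      simp only [List.getD_cons_succ]
      apply ih m hs.2
      split_ifs at h <;> omega

theorem aux_profit_nonneg {n : ℕ} (R : ℕ → ℝ) (hR0 : R 0 = 0) (v : Fin n → ℝ) (q : ℕ)
    (S : Finset (Fin n)) : 0 ≤ capSinglePriceProfit R v q S := by
  unfold capSinglePriceProfit
  refine le_trans ?_ (Finset.le_sup' _ (show 0 ∈ Finset.range (q * S.card + 1) by simp))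
  simp [hR0]

theorem aux_profit {n : ℕ} (R : ℕ → ℝ) (hR0 : R 0 = 0) (v : Fin n → ℝ) (q : ℕ) (hq : 1 ≤ q)
    (S T : Finset (Fin n)) (p : ℝ) (hT : ∀ i ∈ T, v i ≤ p) (m : ℕ) (hm : m ≤ (S ∩ T).card) :
    R (q * m) - ((q * m : ℕ) : ℝ) * p ≤ capSinglePriceProfit R v q S := by
  rcases Nat.eq_zero_or_pos m with rfl | hpos
  · simpa [hR0] using aux_profit_nonneg R hR0 v q S
  unfold capSinglePriceProfit
  have hmS : m ≤ S.card := hm.trans (Finset.card_le_card Finset.inter_subset_left)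
  refine le_trans ?_ (Finset.le_sup' _ (show q * m ∈ Finset.range (q * S.card + 1) by
    rw [Finset.mem_range]
    exact Nat.lt_succ_of_le (Nat.mul_le_mul_left q hmS)))
  have hidx : (q * m + q - 1) / q = m := by
    rw [Nat.add_sub_assoc hq, Nat.mul_add_div hq, Nat.div_eq_of_lt (by omega), add_zero]
  rw [hidx]
  apply sub_le_sub_left
  apply mul_le_mul_of_nonneg_left _ (Nat.cast_nonneg _)
  apply aux_getD
  · exact Multiset.pairwise_sort _ _
  · have h1 : ((S.val.map v).sort (· ≤ ·)).countP (fun a => decide (a ≤ p))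
        = (S.filter (fun i => v i ≤ p)).card := by
      rw [← Multiset.coe_countP, Multiset.sort_eq, Multiset.countP_map]
      rfl
    rw [h1]
    have h2 : (S ∩ T).card ≤ (S.filter (fun i => v i ≤ p)).card := by
      apply Finset.card_le_card
      intro i hi
      rw [Finset.mem_inter] at hi
      exact Finset.mem_filter.mpr ⟨hi.1, hT i hi.2⟩
    omega

theorem aux_pair {n : ℕ} (i j : Fin n) (hij : i ≠ j) :
    ∑ S : Finset (Fin n), (if i ∈ S ∧ j ∈ Sᶜ then (1 : ℝ) else 0) = 2 ^ n / 4 := by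
  rw [Finset.sum_boole]
  have h : (Finset.univ.filter (fun S : Finset (Fin n) => i ∈ S ∧ j ∈ Sᶜ))
      = Finset.Icc {i} ({j}ᶜ) := by
    ext S
    simp only [Finset.mem_filter, Finset.mem_univ, true_and, Finset.mem_Icc, Finset.le_eq_subset,
      Finset.singleton_subset_iff, Finset.subset_compl_singleton, Finset.mem_compl]
  have hn : 2 ≤ n := by
    have h1 := i.2
    have h2 := j.2
    have h3 : i.val ≠ j.val := fun h => hij (Fin.ext h)
    omega
  rw [h, Finset.card_Icc_finset (by simpa using hij.symm)]
  rw [Finset.card_compl, Finset.card_singleton, Finset.card_singleton, Fintype.card_fin]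
  obtain ⟨k, rfl⟩ := Nat.exists_eq_add_of_le hn
  have : 2 + k - 1 - 1 = k := by omega
  rw [this]
  push_cast
  rw [pow_add]
  ring

theorem aux_count {n : ℕ} (T : Finset (Fin n)) :
    ∑ S : Finset (Fin n), ((S ∩ T).card : ℝ) * ((Sᶜ ∩ T).card : ℝ)
      = T.card * (T.card - 1) * (2 ^ n / 4) := by
  have h1 : ∀ S : Finset (Fin n), ((S ∩ T).card : ℝ) * ((Sᶜ ∩ T).card : ℝ)
      = ∑ i ∈ T, ∑ j ∈ T, (if i ∈ S ∧ j ∈ Sᶜ then (1 : ℝ) else 0) := by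
    intro S
    have h : ∀ U : Finset (Fin n), ((U ∩ T).card : ℝ) = ∑ i ∈ T, if i ∈ U then (1 : ℝ) else 0 := by
      intro U
      rw [Finset.sum_boole, Finset.inter_comm, Finset.filter_mem_eq_inter]
    rw [h, h, Finset.sum_mul_sum]
    refine Finset.sum_congr rfl fun i _ => Finset.sum_congr rfl fun j _ => ?_
    by_cases h1 : i ∈ S <;> by_cases h2 : j ∈ Sᶜ <;> simp only [h1, h2] <;> norm_num
  simp_rw [h1]
  rw [Finset.sum_comm]
  have h2 : ∀ i ∈ T, ∑ S : Finset (Fin n), ∑ j ∈ T, (if i ∈ S ∧ j ∈ Sᶜ then (1 : ℝ) else 0)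
      = (T.card - 1) * (2 ^ n / 4) := by
    intro i hi
    rw [Finset.sum_comm, ← Finset.sum_erase_add _ _ hi]
    have h3 : ∑ S : Finset (Fin n), (if i ∈ S ∧ i ∈ Sᶜ then (1 : ℝ) else 0) = 0 := by
      apply Finset.sum_eq_zero
      intro S _
      rw [if_neg]
      simp
    rw [h3, Finset.sum_congr rfl fun j hj => aux_pair i j (Finset.ne_of_mem_erase hj).symm]
    rw [Finset.sum_const, nsmul_eq_mul, Finset.card_erase_of_mem hi,
      Nat.cast_sub (Finset.card_pos.mpr ⟨i, hi⟩)]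
    simp
  rw [Finset.sum_congr rfl h2, Finset.sum_const, nsmul_eq_mul]
  ring

/-- **Theorem 4 of the paper.** PEPAC is 4-competitive for any concave revenue curve
`R` (with `R 0 = 0` and nonincreasing averages `R i / i ≥ R j / j` for `1 ≤ i ≤ j`)
when all `n` sellers have the same capacity `q`: the expected profit
`2^{-n} ∑_{S ⊆ Fin n} min(F_q(S), F_q(Sᶜ))` of PEPAC is at least `1/4` of the optimal
single-price profit `max_{q < x ≤ q·n} (R x − x·v_{⌈x/q⌉})` constrained to buy from at
least two sellers, where `v_j` is the `j`-th lowest per-unit valuation. -/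
theorem pepac_four_competitive_equal_capacities (n : ℕ) (hn : 2 ≤ n)
    (q : ℕ) (hq : 1 ≤ q) (v : Fin n → ℝ) (hv : Monotone v)
    (R : ℕ → ℝ) (hR0 : R 0 = 0)
    (hconc : ∀ i j : ℕ, 1 ≤ i → i ≤ j → (j : ℝ) * R i ≥ (i : ℝ) * R j) :
    ((2 : ℝ) ^ n)⁻¹ *
        ∑ S : Finset (Fin n),
          min (capSinglePriceProfit R v q S) (capSinglePriceProfit R v q Sᶜ) ≥
      (1 / 4) *
        (Finset.Ioc q (q * n)).sup'
          ⟨q + 1, Finset.mem_Ioc.mpr ⟨Nat.lt_succ_self q, by nlinarith⟩⟩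
          (fun x => R x - (x : ℝ) * (List.ofFn v).getD ((x + q - 1) / q - 1) 0) := by
  have key : ∀ x ∈ Finset.Ioc q (q * n),
      (1 / 4) * (R x - (x : ℝ) * (List.ofFn v).getD ((x + q - 1) / q - 1) 0) ≤
      ((2 : ℝ) ^ n)⁻¹ * ∑ S : Finset (Fin n),
          min (capSinglePriceProfit R v q S) (capSinglePriceProfit R v q Sᶜ) := by
    intro x hx
    rw [Finset.mem_Ioc] at hx
    obtain ⟨hx1, hx2⟩ := hx
    obtain ⟨k, hk⟩ : ∃ k, k = (x + q - 1) / q := ⟨_, rfl⟩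
    rw [← hk]
    have hk2 : 2 ≤ k := by
      rw [hk, Nat.le_div_iff_mul_le hq]; omega
    have hkx : x ≤ q * k := by
      have := Nat.lt_mul_div_succ (x + q - 1) hq
      rw [← hk, mul_add] at this
      omega
    have hkx' : q * k ≤ x + q - 1 := by
      rw [hk]; exact Nat.mul_div_le _ _
    have hkn : k ≤ n := by
      by_contra hc
      have : q * (n + 1) ≤ q * k := Nat.mul_le_mul_left q (by omega)
      rw [mul_add] at this
      omega
    have hgd : (List.ofFn v).getD (k - 1) 0 = v ⟨k - 1, by omega⟩ := by
      rw [List.getD_eq_getElem _ _ (by simp; omega)]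
      simp
    rw [hgd]
    set p := v ⟨k - 1, by omega⟩ with hp
    set P := R x - (x : ℝ) * p with hP
    have hmin0 : ∀ S : Finset (Fin n),
        0 ≤ min (capSinglePriceProfit R v q S) (capSinglePriceProfit R v q Sᶜ) := fun S =>
      le_min (aux_profit_nonneg R hR0 v q S) (aux_profit_nonneg R hR0 v q Sᶜ)
    rcases le_or_gt P 0 with hP0 | hP0
    · have : 0 ≤ ((2 : ℝ) ^ n)⁻¹ * ∑ S : Finset (Fin n),
          min (capSinglePriceProfit R v q S) (capSinglePriceProfit R v q Sᶜ) :=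
        mul_nonneg (by positivity) (Finset.sum_nonneg fun S _ => hmin0 S)
      linarith
    set T : Finset (Fin n) := Finset.univ.filter (fun i => i.val < k) with hTdef
    have hTc : T.card = k := by
      rw [hTdef, Fin.card_filter_val_lt]
      exact min_eq_right hkn
    have hT : ∀ i ∈ T, v i ≤ p := by
      intro i hi
      apply hv
      have : i.val < k := by simpa [hTdef] using hi
      rw [Fin.le_def]
      simp only
      omega
    have hkR : (2 : ℝ) ≤ k := by exact_mod_cast hk2
    have hxR : (0 : ℝ) < x := by exact_mod_cast (by omega : 0 < x)
    have hkxR : (x : ℝ) ≤ q * k := by exact_mod_cast hkx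
    have main : ∀ S : Finset (Fin n),
        P / (k * (k - 1)) * (((S ∩ T).card : ℝ) * ((Sᶜ ∩ T).card : ℝ)) ≤
        min (capSinglePriceProfit R v q S) (capSinglePriceProfit R v q Sᶜ) := by
      intro S
      have hadd : (S ∩ T).card + (Sᶜ ∩ T).card = k := by
        rw [← hTc, ← Finset.card_inter_add_card_sdiff T S, Finset.inter_comm S T]
        congr 2
        ext i
        simp [and_comm]
      set a := (S ∩ T).card with ha
      set b := (Sᶜ ∩ T).card with hb
      obtain ⟨m, M, hma, hmb, hmM, hab, hm1⟩ : ∃ m M : ℕ, m ≤ a ∧ m ≤ b ∧ m + M = k ∧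
          a * b = m * M ∧ m ≤ M := by
        rcases le_total a b with h | h
        · exact ⟨a, b, le_rfl, h, hadd, rfl, h⟩
        · exact ⟨b, a, h, le_rfl, by omega, by ring, h⟩
      have habR : (a : ℝ) * b = m * M := by exact_mod_cast hab
      rw [habR]
      rcases Nat.eq_zero_or_pos m with h0 | hmpos
      · rw [h0]; simpa using hmin0 S
      have hlow : P / (k * (k - 1)) * ((m : ℝ) * M) ≤ R (q * m) - ((q * m : ℕ) : ℝ) * p := by
        have hqm : q * m ≤ x := by
          have h1 : q * (m + 1) ≤ q * k := Nat.mul_le_mul_left q (by omega)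
          rw [mul_add] at h1
          omega
        have hc := hconc (q * m) x (Nat.mul_pos hq hmpos) hqm
        have hMk : (M : ℝ) ≤ k - 1 := by
          have : M + 1 ≤ k := by omega
          have : (M : ℝ) + 1 ≤ k := by exact_mod_cast this
          linarith
        have hm0 : (0 : ℝ) < m := by exact_mod_cast hmpos
        have s1 : P / (k * (k - 1)) * ((m : ℝ) * M) ≤ P * m / k := by
          have : P * m / k = P / (k * (k - 1)) * ((m : ℝ) * (k - 1)) := by
            have : (k : ℝ) - 1 ≠ 0 := by linarith
            field_simp
          rw [this]
          have : (0 : ℝ) < k - 1 := by linarith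
          gcongr
        have s2 : P * m / k ≤ P * ((q * m : ℕ) : ℝ) / x := by
          rw [div_le_div_iff₀ (by linarith) hxR]
          push_cast
          have := mul_le_mul_of_nonneg_left hkxR (mul_nonneg hP0.le hm0.le)
          nlinarith
        have s3 : P * ((q * m : ℕ) : ℝ) / x ≤ R (q * m) - ((q * m : ℕ) : ℝ) * p := by
          rw [div_le_iff₀ hxR, hP]
          nlinarith
        linarith
      exact le_min (hlow.trans (aux_profit R hR0 v q hq S T p hT m hma))
        (hlow.trans (aux_profit R hR0 v q hq Sᶜ T p hT m hmb))
    have hsum := Finset.sum_le_sum (s := Finset.univ) fun S _ => main S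
    rw [← Finset.mul_sum, aux_count, hTc] at hsum
    have hk1 : (k : ℝ) - 1 ≠ 0 := by linarith
    have hk0 : (k : ℝ) ≠ 0 := by linarith
    calc (1 / 4) * P
        = ((2 : ℝ) ^ n)⁻¹ * (P / (k * (k - 1)) * (k * (k - 1) * (2 ^ n / 4))) := by
          field_simp
      _ ≤ _ := mul_le_mul_of_nonneg_left hsum (by positivity)
  obtain ⟨x, hx, hxe⟩ := Finset.exists_mem_eq_sup' (s := Finset.Ioc q (q * n))
    ⟨q + 1, Finset.mem_Ioc.mpr ⟨Nat.lt_succ_self q, by nlinarith⟩⟩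
    (fun x => R x - (x : ℝ) * (List.ofFn v).getD ((x + q - 1) / q - 1) 0)
  rw [hxe]
  exact key x hx
end

section
/- Let R : ℕ → ℝ satisfy R 0 = 0 and j·R i ≥ i·R j whenever 1 ≤ i ≤ j. Let k1, k2 be natural numbers with k := k1 + k2 ≥ 1, and let v be a real number with k·v ≤ R k. Then k · min(R k1 − k1·v, R k2 − k2·v) ≥ min(k1, k2) · (R k − k·v). -/
/-- **Key pointwise inequality in the proofs of Theorems 2 and 3 of the paper.**
Let `R` be a revenue curve with `R 0 = 0` and nonincreasing averages
(`j·R i ≥ i·R j` for `1 ≤ i ≤ j`).  If the `k = k1 + k2 ≥ 1` winners of the optimal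
single-price auction at per-unit price `v` (with nonnegative profit `R k − k·v`) are
split into groups of sizes `k1` and `k2`, each group still supports at least a
`min(k1, k2)/k` fraction of the optimal single-price profit:
`k · min(R k1 − k1·v, R k2 − k2·v) ≥ min(k1, k2) · (R k − k·v)`. -/
theorem split_preserves_profit_fraction (R : ℕ → ℝ) (hR0 : R 0 = 0)
    (hconc : ∀ i j : ℕ, 1 ≤ i → i ≤ j → (j : ℝ) * R i ≥ (i : ℝ) * R j)
    (k1 k2 : ℕ) (hk : 1 ≤ k1 + k2) (v : ℝ)
    (hv : ((k1 + k2 : ℕ) : ℝ) * v ≤ R (k1 + k2)) :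
    ((k1 + k2 : ℕ) : ℝ) *
        min (R k1 - (k1 : ℝ) * v) (R k2 - (k2 : ℝ) * v) ≥
      ((min k1 k2 : ℕ) : ℝ) * (R (k1 + k2) - ((k1 + k2 : ℕ) : ℝ) * v) := by
  have key : ∀ i : ℕ, i ≤ k1 + k2 → min k1 k2 ≤ i →
      ((min k1 k2 : ℕ) : ℝ) * (R (k1 + k2) - ((k1 + k2 : ℕ) : ℝ) * v) ≤
        ((k1 + k2 : ℕ) : ℝ) * (R i - (i : ℝ) * v) := by
    intro i hi hm
    have hm' : ((min k1 k2 : ℕ) : ℝ) ≤ (i : ℝ) := Nat.cast_le.mpr hm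
    have h1 : (i : ℝ) * R (k1 + k2) ≤ ((k1 + k2 : ℕ) : ℝ) * R i := by
      rcases Nat.eq_zero_or_pos i with h | h
      · subst h
        simp [hR0]
      · exact hconc i (k1 + k2) h hi
    have h2 := mul_le_mul_of_nonneg_right hm' (sub_nonneg.mpr hv)
    refine h2.trans ?_
    linarith [h1]
  rcases min_choice (R k1 - (k1 : ℝ) * v) (R k2 - (k2 : ℝ) * v) with h | h
  · rw [h]
    exact key k1 (by omega) (min_le_left _ _)
  · rw [h]
    exact key k2 (by omega) (min_le_right _ _)
end

section
/- Let R : ℕ → ℝ satisfy R 0 = 0 and j·R i ≥ i·R j whenever 1 ≤ i ≤ j. Let q ≥ 1 and k1, k2 ≥ 1 be natural numbers with k := k1 + k2, let k' be a natural number with (k−1)·q < k' ≤ k·q, and let v be a real number with k'·v ≤ R k'. Then k · min(R(k1·q) − k1·q·v, R(k2·q) − k2·q·v) ≥ min(k1, k2) · (R k' − k'·v). -/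
theorem split_group_bound (R : ℕ → ℝ)
    (hconc : ∀ i j : ℕ, 1 ≤ i → i ≤ j → (j : ℝ) * R i ≥ (i : ℝ) * R j)
    (q : ℕ) (hq : 1 ≤ q) (a m k k' : ℕ) (ha : 1 ≤ a) (hm : m ≤ a)
    (hl : a * q ≤ k') (hu : k' ≤ k * q) (v : ℝ) (hv : (k' : ℝ) * v ≤ R k') :
    (m : ℝ) * (R k' - (k' : ℝ) * v) ≤ (k : ℝ) * (R (a * q) - ((a * q : ℕ) : ℝ) * v) := by
  have hpos : 1 ≤ a * q := Nat.mul_pos ha hq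
  have h := hconc (a * q) k' hpos hl
  have hk' : (0 : ℝ) < k' := by exact_mod_cast lt_of_lt_of_le hpos hl
  have hq' : (0 : ℝ) < q := by exact_mod_cast hq
  have hu' : (k' : ℝ) ≤ k * q := by exact_mod_cast hu
  have hm' : (m : ℝ) ≤ a := by exact_mod_cast hm
  have hP : 0 ≤ R k' - (k' : ℝ) * v := by linarith
  have h1 : ((a * q : ℕ) : ℝ) * (R k' - k' * v)
      ≤ k' * (R (a * q) - ((a * q : ℕ) : ℝ) * v) := by
    linarith
  have hX : 0 ≤ R (a * q) - ((a * q : ℕ) : ℝ) * v := by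
    have h2 : 0 ≤ ((a * q : ℕ) : ℝ) * (R k' - k' * v) := mul_nonneg (Nat.cast_nonneg _) hP
    exact nonneg_of_mul_nonneg_right (h2.trans h1) hk'
  have h3 := mul_le_mul_of_nonneg_right hu' hX
  have h4 := mul_le_mul_of_nonneg_right hm' hP
  refine h4.trans (le_of_mul_le_mul_left ?_ hq')
  have h5 : ((a * q : ℕ) : ℝ) * (R k' - k' * v) = q * (a * (R k' - k' * v)) := by
    push_cast; ring
  linarith

/-- **Key pointwise inequality in the proof of Theorem 4 of the paper.**
Let `R` be a revenue curve with `R 0 = 0` and nonincreasing averages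
(`j·R i ≥ i·R j` for `1 ≤ i ≤ j`).  Suppose the optimal single-price capacitated
auction buys `k'` units from `k = k1 + k2` sellers of common capacity `q ≥ 1`
(so `(k−1)·q < k' ≤ k·q`) at per-unit price `v` with nonnegative profit
`R k' − k'·v ≥ 0`.  When these sellers are split into groups of sizes `k1, k2 ≥ 1`,
buying at full capacity in each group at price `v` supports at least a
`min(k1, k2)/k` fraction of the optimal profit:
`k · min(R(k1·q) − k1·q·v, R(k2·q) − k2·q·v) ≥ min(k1, k2) · (R k' − k'·v)`. -/
theorem split_preserves_profit_fraction_capacitated (R : ℕ → ℝ) (hR0 : R 0 = 0)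
    (hconc : ∀ i j : ℕ, 1 ≤ i → i ≤ j → (j : ℝ) * R i ≥ (i : ℝ) * R j)
    (q : ℕ) (hq : 1 ≤ q) (k1 k2 : ℕ) (hk1 : 1 ≤ k1) (hk2 : 1 ≤ k2)
    (k' : ℕ) (hk'l : (k1 + k2 - 1) * q < k') (hk'u : k' ≤ (k1 + k2) * q)
    (v : ℝ) (hv : (k' : ℝ) * v ≤ R k') :
    ((k1 + k2 : ℕ) : ℝ) *
        min (R (k1 * q) - ((k1 * q : ℕ) : ℝ) * v) (R (k2 * q) - ((k2 * q : ℕ) : ℝ) * v) ≥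
      ((min k1 k2 : ℕ) : ℝ) * (R k' - (k' : ℝ) * v) := by
  have e1 : k1 * q ≤ k' := (Nat.mul_le_mul_right q (by omega : k1 ≤ k1 + k2 - 1)).trans hk'l.le
  have e2 : k2 * q ≤ k' := (Nat.mul_le_mul_right q (by omega : k2 ≤ k1 + k2 - 1)).trans hk'l.le
  have b1 := split_group_bound R hconc q hq k1 (min k1 k2) (k1 + k2) k' hk1
    (min_le_left _ _) e1 hk'u v hv
  have b2 := split_group_bound R hconc q hq k2 (min k1 k2) (k1 + k2) k' hk2
    (min_le_right _ _) e2 hk'u v hv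
  rw [ge_iff_le, mul_min_of_nonneg _ _ (Nat.cast_nonneg _)]
  exact le_min b1 b2
end

section
/- Let r, v, P, q, q̂ be real numbers and k1, k2 natural numbers with 0 < k2 ≤ k1, P ≥ 0, 0 ≤ q̂ ≤ q, and v ≤ r − P/k1. Then q̂·(r − P/k2) − v·q̂ ≤ q·(r − P/k1) − v·q. -/
/-- **Core inequality in the proof of Lemma 4 / Theorem 7 of the paper.**
In the profit-extraction auction `PEC_P` with linear revenue curve `R x = r·x` and
target profit `P ≥ 0`, a seller with true per-unit valuation `v` and capacity `q` who
underbids her capacity to `q̂ ≤ q` changes the number of procured units from `k1` to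
`k2 ≤ k1` and her per-unit payment from `r − P/k1` to `r − P/k2`.  If she is a winner
when truthful (`v ≤ r − P/k1`), her utility cannot increase by underbidding:
`q̂·(r − P/k2) − v·q̂ ≤ q·(r − P/k1) − v·q`.  Hence capacity-truthful reporting is
dominant and PEPAC is truthful for linear revenue curves. -/
theorem underbidding_capacity_does_not_help (r v P q qhat : ℝ) (k1 k2 : ℕ)
    (hk2 : 0 < k2) (hk12 : k2 ≤ k1) (hP : 0 ≤ P)
    (hqhat : 0 ≤ qhat) (hq : qhat ≤ q) (hv : v ≤ r - P / k1) :
    qhat * (r - P / k2) - v * qhat ≤ q * (r - P / k1) - v * q := by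
  have h2 : (0 : ℝ) < k2 := by exact_mod_cast hk2
  have h12 : (k2 : ℝ) ≤ k1 := by exact_mod_cast hk12
  have h : P / (k1 : ℝ) ≤ P / k2 := div_le_div_of_nonneg_left hP h2 h12
  have ha := mul_nonneg hqhat (sub_nonneg.2 h)
  have hb := mul_nonneg (sub_nonneg.2 hq) (sub_nonneg.2 hv)
  linarith
end

section
/- For every real M > 0 there exist a natural number n ≥ 2, a real r > 0, and a nondecreasing v : Fin n → ℝ such that, with the linear revenue curve R k = r·k, the benchmark F^{(2)} := max_{2 ≤ i ≤ n} (r·i − i·v_i) satisfies F^{(2)} > 0 and the unconstrained optimal single-price profit F := max_{0 ≤ i ≤ n} (r·i − i·v_i) satisfies F > M · F^{(2)}. -/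
/-- **Example 1 of the paper.** The benchmark `F^{(2)}` (the optimal single-price
profit constrained to buy at least two units) can be arbitrarily bad compared to the
unconstrained optimal single-price profit `F`: for every `M > 0` there are `n ≥ 2`
bidders with nondecreasing bids `v` and a linear revenue curve `R k = r·k` (`r > 0`)
such that `F^{(2)} = max_{2 ≤ i ≤ n} (r·i − i·v_i) > 0` while
`F = max_{0 ≤ i ≤ n} (r·i − i·v_i) > M · F^{(2)}` (witnessed, e.g., by bids
`(ε, r − ε, r, …, r)` with `ε` small). -/
theorem benchmark_gap_unbounded (M : ℝ) (hM : 0 < M) :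
    ∃ (n : ℕ) (hn : 2 ≤ n) (r : ℝ), 0 < r ∧
      ∃ v : Fin n → ℝ, Monotone v ∧
        0 < (Finset.Icc 2 n).sup' ⟨2, Finset.mem_Icc.mpr ⟨le_rfl, hn⟩⟩
              (fun i => r * i - (i : ℝ) * (List.ofFn v).getD (i - 1) 0) ∧
        (Finset.range (n + 1)).sup' (by simp)
              (fun i => r * i - (i : ℝ) * (List.ofFn v).getD (i - 1) 0) >
          M * (Finset.Icc 2 n).sup' ⟨2, Finset.mem_Icc.mpr ⟨le_rfl, hn⟩⟩
              (fun i => r * i - (i : ℝ) * (List.ofFn v).getD (i - 1) 0) := by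
  have hF : (Finset.Icc 2 2).sup' ⟨2, Finset.mem_Icc.mpr ⟨le_rfl, le_rfl⟩⟩
      (fun i : ℕ => (2 * M + 2) * (i : ℝ) -
        (i : ℝ) * (List.ofFn ![1, 2 * M + 1]).getD (i - 1) 0) = 2 := by
    simp only [Finset.Icc_self, Finset.sup'_singleton]
    simp
    ring
  refine ⟨2, le_rfl, 2 * M + 2, by linarith, ![1, 2 * M + 1], ?_, ?_, ?_⟩
  · intro i j hij
    fin_cases i <;> fin_cases j <;> simp at hij ⊢
    linarith
  · rw [hF]
    norm_num
  · rw [hF, gt_iff_lt, Finset.lt_sup'_iff]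
    refine ⟨1, by simp, ?_⟩
    simp
    linarith
end
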